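/- arXiv:2103.02223 — 5 statements merged into one kernel-verified Lean document; each statement's English description precedes it below -/
import Mathlib

section
/- For every complex number a with Re(a) > 0 and every real c > 0, ∫_0^1 x^{a-1} e^{-cx} dx = e^{-c} · Σ_{m=0}^∞ c^m / (a(a+1)(a+2)⋯(a+m)), where the series on the right converges absolutely. -/
open MeasureTheory

lemma hasSum_aux (a : ℂ) (ha : 0 < a.re) (c : ℝ) (hc : 0 < c) :
    HasSum (fun m : ℕ => (c : ℂ) ^ m / ∏ j ∈ Finset.range (m + 1), (a + j))
      (∫ x in (0 : ℝ)..1, (x : ℂ) ^ (a - 1) * Complex.exp (c * (1 - x))) := by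
  have key : ∀ m : ℕ, (c : ℂ) ^ m / ∏ j ∈ Finset.range (m + 1), (a + j) =
      ∫ x in (0 : ℝ)..1, (x : ℂ) ^ (a - 1) * ((c * (1 - x)) ^ m / (m.factorial : ℂ)) := by
    intro m
    have h := Complex.betaIntegral_eval_nat_add_one_right ha m
    have hf : (m.factorial : ℂ) ≠ 0 := by exact_mod_cast m.factorial_ne_zero
    have e : (c : ℂ) ^ m / ∏ j ∈ Finset.range (m + 1), (a + j) =
        (c : ℂ) ^ m / (m.factorial : ℂ) * Complex.betaIntegral a (m + 1) := by
      rw [h, div_mul_div_comm, mul_comm (m.factorial : ℂ), mul_div_mul_right _ _ hf]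
    rw [e, Complex.betaIntegral, ← intervalIntegral.integral_const_mul]
    congr 1
    ext x
    rw [add_sub_cancel_right, Complex.cpow_natCast, mul_pow]
    ring
  simp_rw [key]
  have hint : IntervalIntegrable (fun t : ℝ => (t : ℝ) ^ (a.re - 1)) volume 0 1 :=
    intervalIntegral.intervalIntegrable_rpow' (by linarith)
  apply intervalIntegral.hasSum_integral_of_dominated_convergence
    (fun n t => t ^ (a.re - 1) * (c ^ n / (n.factorial : ℝ)))
  · intro n
    have h1 : IntervalIntegrable (fun t : ℝ => (t : ℂ) ^ (a - 1)) volume 0 1 :=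
      intervalIntegral.intervalIntegrable_cpow' (by simpa using ha)
    have h2 := (intervalIntegrable_iff.1 h1).aestronglyMeasurable
    refine h2.mul (Continuous.aestronglyMeasurable ?_)
    fun_prop
  · intro n
    refine Filter.Eventually.of_forall fun t ht => ?_
    rw [Set.uIoc_of_le zero_le_one] at ht
    rw [norm_mul, Complex.norm_cpow_eq_rpow_re_of_pos ht.1, norm_div, norm_pow, norm_mul]
    have : ‖(1 - t : ℂ)‖ ≤ 1 := by
      rw [← Complex.ofReal_one, ← Complex.ofReal_sub, Complex.norm_real, Real.norm_eq_abs,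
        abs_le]
      constructor <;> linarith [ht.1, ht.2]
    have h3 : ‖(c : ℂ)‖ = c := by simp [hc.le]
    have h4 : ‖(c : ℂ)‖ * ‖(1 - t : ℂ)‖ ≤ c := by
      rw [h3]; nlinarith
    have h5 : (0 : ℝ) ≤ t ^ (a.re - 1) := Real.rpow_nonneg ht.1.le _
    simp only [Complex.sub_re, Complex.one_re, Complex.norm_natCast]
    gcongr
  · refine Filter.Eventually.of_forall fun t _ => ?_
    exact (Real.summable_pow_div_factorial c).mul_left _
  · simp_rw [tsum_mul_left]
    exact hint.mul_const _
  · refine Filter.Eventually.of_forall fun t _ => ?_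
    apply HasSum.mul_left
    rw [Complex.exp_eq_exp_ℂ]
    exact NormedSpace.expSeries_div_hasSum_exp _

/-- For `Re(a) > 0` and `c > 0`,
`∫_0^1 x^{a-1} e^{-cx} dx = e^{-c} ∑_{m=0}^∞ c^m / (a(a+1)⋯(a+m))`,
the series converging absolutely. -/
theorem integral_eq_exp_mul_tsum (a : ℂ) (ha : 0 < a.re) (c : ℝ) (hc : 0 < c) :
    Summable (fun m : ℕ => ‖(c : ℂ) ^ m / ∏ j ∈ Finset.range (m + 1), (a + j)‖) ∧
    ∫ x in (0 : ℝ)..1, (x : ℂ) ^ (a - 1) * (Real.exp (-c * x) : ℂ) =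
      (Real.exp (-c) : ℂ) *
        ∑' m : ℕ, (c : ℂ) ^ m / ∏ j ∈ Finset.range (m + 1), (a + j) := by
  have h := hasSum_aux a ha c hc
  refine ⟨h.summable.norm, ?_⟩
  rw [h.tsum_eq, ← intervalIntegral.integral_const_mul]
  congr 1
  ext x
  rw [mul_left_comm, Complex.ofReal_exp, Complex.ofReal_exp, ← Complex.exp_add]
  congr 2
  push_cast
  ring
end

section
/- For every complex number s with Re(s) > 1, the series J(s) := Σ_{m=1}^∞ c_m / ((s/2)(s/2+1)⋯(s/2+m-1)) converges absolutely, and J(s) = ∫_0^1 x^{s/2-1} ψ(x) dx. -/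
open MeasureTheory

/-- `ψ(x) = ∑_{n=1}^∞ e^{-n²πx}`. -/
noncomputable def psi (x : ℝ) : ℝ := ∑' n : ℕ, Real.exp (-(n + 1 : ℝ) ^ 2 * Real.pi * x)

/-- `cCoef m = c_{m+1} = ∑_{n=1}^∞ e^{-n²π} (n²π)^m`, the coefficient of the
`(m+1)`-st term of the series `J`. -/
noncomputable def cCoef (m : ℕ) : ℝ :=
  ∑' n : ℕ, Real.exp (-(n + 1 : ℝ) ^ 2 * Real.pi) * ((n + 1 : ℝ) ^ 2 * Real.pi) ^ m

/-- `J(s) = ∑_{m=1}^∞ c_m / ((s/2)(s/2+1)⋯(s/2+m-1))`. -/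
noncomputable def J (s : ℂ) : ℂ :=
  ∑' m : ℕ, (cCoef m : ℂ) / ∏ k ∈ Finset.range (m + 1), (s / 2 + k)

noncomputable def aa (n : ℕ) : ℝ := (n + 1 : ℝ) ^ 2 * Real.pi

lemma aa_pos (n : ℕ) : 0 < aa n := by
  unfold aa; have := Real.pi_pos; positivity

noncomputable def FF (u : ℂ) (p : ℕ × ℕ) (x : ℝ) : ℂ :=
  (x : ℂ) ^ (u - 1) * ((Real.exp (-aa p.1) * ((aa p.1 * (1 - x)) ^ p.2 / (p.2.factorial : ℝ)) : ℝ) : ℂ)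

lemma FF_eq (u : ℂ) (p : ℕ × ℕ) (x : ℝ) :
    FF u p x = ((Real.exp (-aa p.1) * aa p.1 ^ p.2 / (p.2.factorial : ℝ) : ℝ) : ℂ) *
      ((x : ℂ) ^ (u - 1) * (1 - (x : ℂ)) ^ (((p.2 : ℂ) + 1) - 1)) := by
  unfold FF
  rw [add_sub_cancel_right, Complex.cpow_natCast]
  push_cast
  rw [mul_pow]
  ring

lemma FF_int (u : ℂ) (hu : 0 < u.re) (p : ℕ × ℕ) :
    Integrable (FF u p) (volume.restrict (Set.Ioc (0:ℝ) 1)) := by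
  have h := Complex.betaIntegral_convergent (u := u) (v := (p.2 : ℂ) + 1) hu
    (by simp; positivity)
  rw [intervalIntegrable_iff_integrableOn_Ioc_of_le zero_le_one] at h
  have := h.const_mul ((Real.exp (-aa p.1) * aa p.1 ^ p.2 / (p.2.factorial : ℝ) : ℝ) : ℂ)
  refine this.congr (Filter.Eventually.of_forall fun x => ?_)
  exact (FF_eq u p x).symm

lemma FF_integral (u : ℂ) (hu : 0 < u.re) (p : ℕ × ℕ) :
    ∫ x in Set.Ioc (0:ℝ) 1, FF u p x =
      ((Real.exp (-aa p.1) * aa p.1 ^ p.2 : ℝ) : ℂ) / ∏ k ∈ Finset.range (p.2 + 1), (u + k) := by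
  have h := Complex.betaIntegral_eval_nat_add_one_right hu p.2
  rw [Complex.betaIntegral, intervalIntegral.integral_of_le zero_le_one] at h
  simp_rw [FF_eq]
  rw [integral_const_mul, h]
  have : (p.2.factorial : ℂ) ≠ 0 := by exact_mod_cast p.2.factorial_ne_zero
  push_cast
  field_simp

lemma FF_norm (u : ℂ) (p : ℕ × ℕ) {x : ℝ} (hx : x ∈ Set.Ioc (0:ℝ) 1) :
    ‖FF u p x‖ = x ^ (u.re - 1) *
      (Real.exp (-aa p.1) * ((aa p.1 * (1 - x)) ^ p.2 / (p.2.factorial : ℝ))) := by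
  have h1 : 0 ≤ 1 - x := by linarith [hx.2]
  have := aa_pos p.1
  unfold FF
  rw [norm_mul, Complex.norm_cpow_eq_rpow_re_of_pos hx.1, Complex.norm_real,
    Real.norm_of_nonneg (by positivity)]
  simp

lemma hasSum_inner (n : ℕ) (x : ℝ) :
    HasSum (fun m : ℕ => Real.exp (-aa n) * ((aa n * (1 - x)) ^ m / (m.factorial : ℝ)))
      (Real.exp (-aa n * x)) := by
  have h := (NormedSpace.expSeries_div_hasSum_exp (𝔸 := ℝ) (aa n * (1 - x))).mul_left
    (Real.exp (-aa n))
  rw [← Real.exp_eq_exp_ℝ, ← Real.exp_add] at h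
  have e : -aa n * x = -aa n + aa n * (1 - x) := by ring
  rw [e]
  exact h

lemma FF_norm_summable (u : ℂ) (hu : 1 / 2 < u.re) :
    Summable fun p : ℕ × ℕ => ∫ x in Set.Ioc (0:ℝ) 1, ‖FF u p x‖ := by
  have hu0 : 0 < u.re := by linarith
  have hnn : ∀ p : ℕ × ℕ, 0 ≤ ∫ x in Set.Ioc (0:ℝ) 1, ‖FF u p x‖ :=
    fun p => integral_nonneg fun x => norm_nonneg _
  have key : ∀ n : ℕ, ∀ S : Finset ℕ,
      ∑ m ∈ S, ∫ x in Set.Ioc (0:ℝ) 1, ‖FF u (n, m) x‖ ≤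
        (1 / aa n) ^ u.re * Real.Gamma u.re := by
    intro n S
    have ha := aa_pos n
    rw [← integral_finsetSum _ (fun m _ => (FF_int u hu0 (n, m)).norm)]
    rw [← Real.integral_rpow_mul_exp_neg_mul_Ioi hu0 ha]
    have hI : IntegrableOn (fun t : ℝ => t ^ (u.re - 1) * Real.exp (-(aa n * t))) (Set.Ioi 0) := by
      by_contra hc
      have h0 := Real.integral_rpow_mul_exp_neg_mul_Ioi hu0 ha
      rw [integral_undef hc] at h0
      have : 0 < (1 / aa n) ^ u.re * Real.Gamma u.re :=
        mul_pos (by positivity) (Real.Gamma_pos_of_pos hu0)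
      linarith
    calc _ ≤ ∫ t in Set.Ioc (0:ℝ) 1, t ^ (u.re - 1) * Real.exp (-(aa n * t)) := by
          refine setIntegral_mono_on
            (integrable_finsetSum _ (fun m _ => (FF_int u hu0 (n, m)).norm))
            (hI.mono_set Set.Ioc_subset_Ioi_self) measurableSet_Ioc ?_
          intro x hx
          have h1 : 0 ≤ 1 - x := by linarith [hx.2]
          rw [Finset.sum_congr rfl (fun m _ => FF_norm u (n, m) hx), ← Finset.mul_sum]
          have hs := hasSum_inner n x
          rw [neg_mul] at hs
          exact mul_le_mul_of_nonneg_left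
            (sum_le_hasSum S (fun m _ => by positivity) hs) (Real.rpow_nonneg hx.1.le _)
      _ ≤ _ := by
          refine setIntegral_mono_set hI ?_ Set.Ioc_subset_Ioi_self.eventuallyLE
          filter_upwards [ae_restrict_mem measurableSet_Ioi] with x hx
          have : (0:ℝ) < x := hx
          simp only [Pi.zero_apply]
          positivity
  rw [summable_prod_of_nonneg hnn]
  refine ⟨fun n => summable_of_sum_le (fun m => hnn (n, m)) (key n), ?_⟩
  have hb : Summable fun n : ℕ => (1 / aa n) ^ u.re * Real.Gamma u.re := by
    apply Summable.mul_right
    have h1 : Summable fun n : ℕ => 1 / ((n + 1 : ℕ) : ℝ) ^ (2 * u.re) :=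
      (summable_nat_add_iff 1).2 (Real.summable_one_div_nat_rpow.2 (by linarith))
    refine (h1.mul_right ((1 / Real.pi) ^ u.re)).congr fun n => ?_
    unfold aa
    have := Real.pi_pos
    rw [← one_div_mul_one_div, Real.mul_rpow (by positivity) (by positivity),
      Real.rpow_mul (by positivity), Real.div_rpow (by positivity) (by positivity), Real.one_rpow]
    rw [Real.div_rpow (by positivity) (by positivity), Real.one_rpow]
    norm_num
  exact hb.of_nonneg_of_le (fun n => tsum_nonneg fun m => hnn (n, m))
    (fun n => (summable_of_sum_le (fun m => hnn (n, m)) (key n)).tsum_le_of_sum_le (key n))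

lemma summable_psi {x : ℝ} (hx : 0 < x) : Summable fun n : ℕ => Real.exp (-aa n * x) := by
  have h : Summable fun n : ℕ => Real.exp (n * (-(Real.pi * x))) :=
    Real.summable_exp_nat_mul_iff.2 (by have := Real.pi_pos; simp; positivity)
  refine h.of_nonneg_of_le (fun n => (Real.exp_pos _).le) fun n => Real.exp_le_exp.2 ?_
  unfold aa
  have h2 : (n:ℝ) ≤ (n + 1 : ℝ) ^ 2 := by nlinarith [(Nat.cast_nonneg n : (0:ℝ) ≤ n)]
  have h3 : 0 < Real.pi * x := mul_pos Real.pi_pos hx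
  nlinarith [mul_le_mul_of_nonneg_right h2 h3.le]

lemma FF_tsum (u : ℂ) {x : ℝ} (hx : x ∈ Set.Ioc (0:ℝ) 1) :
    ∑' p, FF u p x = (x : ℂ) ^ (u - 1) * (psi x : ℂ) := by
  unfold FF
  rw [tsum_mul_left, ← Complex.ofReal_tsum]
  congr 2
  have h1 : 0 ≤ 1 - x := by linarith [hx.2]
  have hs : Summable fun p : ℕ × ℕ =>
      Real.exp (-aa p.1) * ((aa p.1 * (1 - x)) ^ p.2 / (p.2.factorial : ℝ)) := by
    rw [summable_prod_of_nonneg (fun p => by have := aa_pos p.1; simp only [Pi.zero_apply]; positivity)]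
    refine ⟨fun n => (hasSum_inner n x).summable, ?_⟩
    refine (summable_psi hx.1).congr fun n => ?_
    exact (hasSum_inner n x).tsum_eq.symm
  rw [hs.tsum_prod]
  unfold psi
  refine tsum_congr fun n => ?_
  rw [(hasSum_inner n x).tsum_eq]
  unfold aa
  congr 1
  ring

/-- For `Re(s) > 1`, the series `J(s)` converges absolutely and equals
`∫_0^1 x^{s/2-1} ψ(x) dx`. -/
theorem J_summable_and_eq_integral (s : ℂ) (hs : 1 < s.re) :
    Summable
      (fun m : ℕ => ‖(cCoef m : ℂ) / ∏ k ∈ Finset.range (m + 1), (s / 2 + k)‖) ∧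
    J s = ∫ x in (0 : ℝ)..1, (x : ℂ) ^ (s / 2 - 1) * (psi x : ℂ) := by
  have hu : 1 / 2 < (s / 2).re := by
    have : (s / 2).re = s.re / 2 := by simp
    rw [this]; linarith
  have hu0 : 0 < (s / 2).re := by linarith
  have hN := FF_norm_summable (s / 2) hu
  have hH := hasSum_integral_of_summable_integral_norm (FF_int (s / 2) hu0) hN
  have hS : Summable fun p : ℕ × ℕ => ‖∫ x in Set.Ioc (0:ℝ) 1, FF (s / 2) p x‖ :=
    hN.of_nonneg_of_le (fun p => norm_nonneg _) fun p => norm_integral_le_integral_norm _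
  have hS' := hS.prod_symm
  have hT : ∀ m : ℕ, ∑' n : ℕ, ∫ x in Set.Ioc (0:ℝ) 1, FF (s / 2) (n, m) x =
      (cCoef m : ℂ) / ∏ k ∈ Finset.range (m + 1), (s / 2 + k) := by
    intro m
    simp_rw [FF_integral _ hu0]
    rw [tsum_div_const, ← Complex.ofReal_tsum]
    simp only [cCoef, aa, neg_mul]
  constructor
  · refine hS'.prod.of_nonneg_of_le (fun m => norm_nonneg _) fun m => ?_
    rw [← hT m]
    exact norm_tsum_le_tsum_norm (hS'.prod_factor m)
  · rw [intervalIntegral.integral_of_le zero_le_one,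
      ← setIntegral_congr_fun measurableSet_Ioc (fun x hx => FF_tsum (s / 2) hx), ← hH.tsum_eq]
    unfold J
    simp_rw [← hT]
    rw [← (Equiv.prodComm ℕ ℕ).tsum_eq]
    exact (Summable.tsum_prod hS'.of_norm).symm
end

section
/- For every complex number s with Re(s) > 1, π^{-s/2} · Γ(s/2) · ζ(s) = J(s) + ∫_1^∞ x^{s/2-1} ψ(x) dx. -/
open MeasureTheory

lemma aux_meas (a : ℂ) (S : Set ℝ) (hS : MeasurableSet S) (h0 : S ⊆ Set.Ioi 0) :
    AEStronglyMeasurable (fun x : ℝ => (x : ℂ) ^ (a - 1)) (volume.restrict S) := by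
  apply ContinuousOn.aestronglyMeasurable _ hS
  intro x hx
  apply ContinuousAt.continuousWithinAt
  exact Complex.continuousAt_ofReal_cpow_const x (a - 1) (Or.inr (ne_of_gt (h0 hx)))

lemma aux_real_int {σ l : ℝ} (hσ : 0 < σ) (hl : 0 < l) :
    IntegrableOn (fun x : ℝ => x ^ (σ - 1) * Real.exp (-l * x)) (Set.Ioi 0) := by
  have := integrableOn_rpow_mul_exp_neg_mul_rpow (p := 1) (s := σ - 1) (b := l)
    (by linarith) one_pos hl
  simpa using this

lemma aux_norm {a : ℂ} {l x : ℝ} (hx : 0 < x) :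
    ‖(x : ℂ) ^ (a - 1) * (Real.exp (-l * x) : ℂ)‖ = x ^ (a.re - 1) * Real.exp (-l * x) := by
  rw [norm_mul, Complex.norm_cpow_eq_rpow_re_of_pos hx, Complex.norm_real, Real.norm_eq_abs,
    abs_of_pos (Real.exp_pos _)]
  simp

lemma aux_int {a : ℂ} {l : ℝ} (ha : 0 < a.re) (hl : 0 < l) :
    IntegrableOn (fun x : ℝ => (x : ℂ) ^ (a - 1) * (Real.exp (-l * x) : ℂ)) (Set.Ioi 0) := by
  refine Integrable.mono' (aux_real_int ha hl) ?_ ?_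
  · refine (aux_meas a _ measurableSet_Ioi subset_rfl).mul ?_
    exact (Continuous.aestronglyMeasurable (by fun_prop))
  · filter_upwards [ae_restrict_mem measurableSet_Ioi] with x hx
    exact (aux_norm hx).le

lemma aux_hasSum {a : ℂ} (l : ℝ) (ha : 0 < a.re) :
    HasSum (fun m : ℕ => ((Real.exp (-l) * l ^ m : ℝ) : ℂ) / ∏ k ∈ Finset.range (m + 1), (a + k))
      (∫ x in Set.Ioc (0 : ℝ) 1, (x : ℂ) ^ (a - 1) * (Real.exp (-l * x) : ℂ)) := by
  have key : HasSum (fun m : ℕ => ∫ x in Set.Ioc (0 : ℝ) 1,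
      (x : ℂ) ^ (a - 1) * ((Real.exp (-l) * ((l * (1 - x)) ^ m / m.factorial) : ℝ) : ℂ))
      (∫ x in Set.Ioc (0 : ℝ) 1, (x : ℂ) ^ (a - 1) * (Real.exp (-l * x) : ℂ)) := by
    have hb : ∀ x : ℝ, HasSum (fun m : ℕ => x ^ (a.re - 1) * (Real.exp (-l) * (|l| ^ m / m.factorial)))
        (x ^ (a.re - 1) * (Real.exp (-l) * Real.exp |l|)) := by
      intro x
      rw [Real.exp_eq_exp_ℝ]
      exact ((NormedSpace.expSeries_div_hasSum_exp |l|).mul_left _).mul_left _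
    apply hasSum_integral_of_dominated_convergence
      (fun (m : ℕ) (x : ℝ) => x ^ (a.re - 1) * (Real.exp (-l) * (|l| ^ m / m.factorial)))
    · intro m
      refine (aux_meas a _ measurableSet_Ioc (fun x hx => hx.1)).mul ?_
      exact (Continuous.aestronglyMeasurable (by fun_prop))
    · intro m
      filter_upwards [ae_restrict_mem measurableSet_Ioc] with x hx
      rw [norm_mul, Complex.norm_cpow_eq_rpow_re_of_pos hx.1, Complex.norm_real, norm_mul,
        norm_div, norm_pow, norm_mul]
      simp only [Real.norm_eq_abs, Complex.sub_re, Complex.one_re, Real.abs_exp, Nat.abs_cast]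
      have h1 : |1 - x| ≤ 1 := by
        rw [abs_le]; constructor <;> linarith [hx.1, hx.2]
      have h2 : 0 ≤ x ^ (a.re - 1) := Real.rpow_nonneg hx.1.le _
      have h3 : |l| * |1 - x| ≤ |l| := mul_le_of_le_one_right (abs_nonneg _) h1
      gcongr
    · exact Filter.Eventually.of_forall fun x => (hb x).summable
    · simp_rw [fun x => (hb x).tsum_eq]
      have := (intervalIntegral.intervalIntegrable_rpow' (a := 0) (b := 1) (r := a.re - 1)
        (by linarith)).1
      exact this.mul_const _
    · refine Filter.Eventually.of_forall fun x => ?_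
      have h := (NormedSpace.expSeries_div_hasSum_exp (l * (1 - x))).mul_left (Real.exp (-l))
      rw [← Real.exp_eq_exp_ℝ, ← Real.exp_add] at h
      have h' := (Complex.hasSum_ofReal.mpr h).mul_left ((x : ℂ) ^ (a - 1))
      have e : -l * x = -l + l * (1 - x) := by ring
      rw [e]
      exact h'
  convert key using 2 with m
  have hB := Complex.betaIntegral_eval_nat_add_one_right ha m
  rw [Complex.betaIntegral, intervalIntegral.integral_of_le zero_le_one] at hB
  have : ∀ x : ℝ, (x : ℂ) ^ (a - 1) * ((Real.exp (-l) * ((l * (1 - x)) ^ m / m.factorial) : ℝ) : ℂ)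
      = ((Real.exp (-l) * l ^ m / m.factorial : ℝ) : ℂ) *
        ((x : ℂ) ^ (a - 1) * (1 - (x : ℂ)) ^ ((m : ℂ) + 1 - 1)) := by
    intro x
    rw [add_sub_cancel_right, Complex.cpow_natCast, mul_pow]
    push_cast
    ring
  simp_rw [this]
  rw [integral_const_mul, hB]
  have hm : (m.factorial : ℂ) ≠ 0 := by exact_mod_cast m.factorial_ne_zero
  push_cast
  field_simp

/-- The exponents. -/
noncomputable def lam (n : ℕ) : ℝ := (n + 1 : ℝ) ^ 2 * Real.pi

lemma lam_pos (n : ℕ) : 0 < lam n := by unfold lam; positivity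

lemma summable_gamma {σ : ℝ} (hσ : 1 / 2 < σ) :
    Summable (fun n : ℕ => ∫ x in Set.Ioi (0 : ℝ), x ^ (σ - 1) * Real.exp (-lam n * x)) := by
  have h : Summable (fun n : ℕ => 1 / |(n : ℝ) + 1| ^ (2 * σ)) :=
    (Real.summable_one_div_nat_add_rpow 1 (2 * σ)).mpr (by linarith)
  have h2 := h.mul_left ((1 / Real.pi) ^ σ * Real.Gamma σ)
  refine h2.congr fun n => ?_
  have := Real.integral_rpow_mul_exp_neg_mul_Ioi (a := σ) (by linarith) (lam_pos n)
  simp_rw [neg_mul, this]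
  have hn : (0 : ℝ) < n + 1 := by positivity
  rw [abs_of_pos hn, lam, ← one_div_mul_one_div, Real.mul_rpow (by positivity) (by positivity),
    Real.div_rpow (x := 1) zero_le_one (by positivity),
    Real.div_rpow (x := 1) (y := ((n : ℝ) + 1) ^ 2) zero_le_one (by positivity), Real.one_rpow, ← Real.rpow_natCast,
    ← Real.rpow_mul hn.le]
  push_cast
  ring

lemma real_sub_le {σ l : ℝ} (hσ : 0 < σ) (hl : 0 < l) (S : Set ℝ) (h0 : S ⊆ Set.Ioi 0) :
    ∫ x in S, x ^ (σ - 1) * Real.exp (-l * x) ≤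
      ∫ x in Set.Ioi (0 : ℝ), x ^ (σ - 1) * Real.exp (-l * x) := by
  refine setIntegral_mono_set (aux_real_int hσ hl) ?_ (Filter.Eventually.of_forall h0)
  filter_upwards [ae_restrict_mem measurableSet_Ioi] with x hx
  exact mul_nonneg (Real.rpow_nonneg (le_of_lt hx) _) (Real.exp_pos _).le

lemma aux_hasSum_real {σ : ℝ} (l : ℝ) (hσ : 0 < σ) :
    HasSum (fun m : ℕ => (Real.exp (-l) * l ^ m) / ∏ k ∈ Finset.range (m + 1), (σ + k))
      (∫ x in Set.Ioc (0 : ℝ) 1, x ^ (σ - 1) * Real.exp (-l * x)) := by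
  have h := aux_hasSum (a := (σ : ℂ)) l (by simpa using hσ)
  rw [← Complex.hasSum_ofReal, ← integral_complex_ofReal]
  convert h using 1
  · ext m; push_cast; rfl
  · refine setIntegral_congr_fun measurableSet_Ioc fun x hx => ?_
    rw [Complex.ofReal_mul, Complex.ofReal_cpow hx.1.le]
    push_cast; rfl

lemma summable_double {a : ℂ} (ha : 1 / 2 < a.re) :
    Summable (Function.uncurry fun n m : ℕ =>
      ((Real.exp (-lam n) * lam n ^ m : ℝ) : ℂ) / ∏ k ∈ Finset.range (m + 1), (a + k)) := by
  have ha0 : 0 < a.re := by linarith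
  have hpos : ∀ m : ℕ, 0 < ∏ k ∈ Finset.range (m + 1), (a.re + k) := fun m =>
    Finset.prod_pos fun k _ => by positivity
  refine Summable.of_norm_bounded (g := Function.uncurry fun n m : ℕ =>
      (Real.exp (-lam n) * lam n ^ m) / ∏ k ∈ Finset.range (m + 1), (a.re + k)) ?_ ?_
  · rw [summable_prod_of_nonneg]
    · refine ⟨fun n => (aux_hasSum_real (lam n) ha0).summable, ?_⟩
      simp only [Function.uncurry]
      simp_rw [fun n => (aux_hasSum_real (lam n) ha0).tsum_eq]
      refine Summable.of_nonneg_of_le (fun n => ?_) (fun n => ?_) (summable_gamma ha)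
      · refine setIntegral_nonneg measurableSet_Ioc fun x hx => ?_
        exact mul_nonneg (Real.rpow_nonneg (le_of_lt hx.1) _) (Real.exp_pos _).le
      · exact real_sub_le ha0 (lam_pos n) _ fun x hx => hx.1
    · rintro ⟨n, m⟩
      have := lam_pos n
      have := hpos m
      simp only [Function.uncurry, Pi.zero_apply]
      positivity
  · rintro ⟨n, m⟩
    have hl := lam_pos n
    have := hpos m
    simp only [Function.uncurry]
    rw [norm_div, Complex.norm_real, Real.norm_of_nonneg (by positivity), norm_prod]
    gcongr with k hk
    calc a.re + k = (a + k).re := by simp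
      _ ≤ ‖a + k‖ := Complex.re_le_norm _

lemma hasSum_tail {a : ℂ} (ha : 1 / 2 < a.re) :
    HasSum (fun n : ℕ => ∫ x in Set.Ioi (1 : ℝ), (x : ℂ) ^ (a - 1) * (Real.exp (-lam n * x) : ℂ))
      (∫ x in Set.Ioi (1 : ℝ), (x : ℂ) ^ (a - 1) * (psi x : ℂ)) := by
  have ha0 : 0 < a.re := by linarith
  have hsub : Set.Ioi (1 : ℝ) ⊆ Set.Ioi 0 := Set.Ioi_subset_Ioi zero_le_one
  have h := hasSum_integral_of_summable_integral_norm (E := ℂ) (μ := volume.restrict (Set.Ioi (1 : ℝ)))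
    (F := fun (n : ℕ) (x : ℝ) => (x : ℂ) ^ (a - 1) * (Real.exp (-lam n * x) : ℂ))
    (fun n => (aux_int ha0 (lam_pos n)).mono_set hsub) ?_
  · have e : ∀ x : ℝ, (x : ℂ) ^ (a - 1) * (psi x : ℂ) =
        ∑' n : ℕ, (x : ℂ) ^ (a - 1) * (Real.exp (-lam n * x) : ℂ) := by
      intro x
      rw [tsum_mul_left, psi, Complex.ofReal_tsum]
      simp only [lam, neg_mul]
    simp_rw [e]
    exact h
  · refine Summable.of_nonneg_of_le (fun n => integral_nonneg fun x => norm_nonneg _) (fun n => ?_)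
      (summable_gamma ha)
    rw [setIntegral_congr_fun measurableSet_Ioi (fun x hx => aux_norm (hsub hx))]
    exact real_sub_le ha0 (lam_pos n) _ hsub

lemma gamma_term (s : ℂ) (hs : 1 < s.re) (n : ℕ) :
    (Real.pi : ℂ) ^ (-s / 2) * Complex.Gamma (s / 2) * (1 / ((n : ℂ) + 1) ^ s) =
      ∫ x in Set.Ioi (0 : ℝ), (x : ℂ) ^ (s / 2 - 1) * (Real.exp (-lam n * x) : ℂ) := by
  have ha : 0 < (s / 2).re := by simp; linarith
  have h := Complex.integral_cpow_mul_exp_neg_mul_Ioi ha (lam_pos n)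
  have hn : (0 : ℝ) < n + 1 := by positivity
  have e : (1 / (lam n : ℂ)) ^ (s / 2) = (Real.pi : ℂ) ^ (-s / 2) * (1 / ((n : ℂ) + 1) ^ s) := by
    have h1 : (((n : ℝ) + 1 : ℝ) : ℂ) ^ s = ((((n : ℝ) + 1) ^ 2 : ℝ) : ℂ) ^ (s / 2) := by
      rw [pow_two, Complex.ofReal_mul, Complex.mul_cpow_ofReal_nonneg hn.le hn.le,
        ← Complex.cpow_add _ _ (by exact_mod_cast hn.ne'), add_halves]
    push_cast at h1
    rw [h1, one_div, Complex.inv_cpow, lam, Complex.ofReal_mul,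
      Complex.mul_cpow_ofReal_nonneg (by positivity) Real.pi_pos.le, neg_div, Complex.cpow_neg]
    · push_cast
      rw [mul_inv, one_div, mul_comm]
    · rw [Complex.arg_ofReal_of_nonneg (lam_pos n).le]
      exact Real.pi_pos.ne
  rw [e] at h
  simp only [Complex.ofReal_exp, Complex.ofReal_mul, Complex.ofReal_neg, neg_mul]
  rw [h]
  ring

/-- For `Re(s) > 1`, `π^{-s/2} Γ(s/2) ζ(s) = J(s) + ∫_1^∞ x^{s/2-1} ψ(x) dx`. -/
theorem completed_zeta_eq_J_add_integral (s : ℂ) (hs : 1 < s.re) :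
    (Real.pi : ℂ) ^ (-s / 2) * Complex.Gamma (s / 2) * riemannZeta s =
      J s + ∫ x in Set.Ioi (1 : ℝ), (x : ℂ) ^ (s / 2 - 1) * (psi x : ℂ) := by
  have ha : 1 / 2 < (s / 2).re := by simp; linarith
  have ha0 : 0 < (s / 2).re := by linarith
  have hd := summable_double ha
  have hJ : J s = ∑' n : ℕ, ∫ x in Set.Ioc (0 : ℝ) 1,
      (x : ℂ) ^ (s / 2 - 1) * (Real.exp (-lam n * x) : ℂ) := by
    simp_rw [← fun n => (aux_hasSum (lam n) ha0).tsum_eq]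
    rw [← hd.tsum_comm, J]
    refine tsum_congr fun m => ?_
    rw [tsum_div_const, cCoef, Complex.ofReal_tsum]
    simp only [lam, neg_mul]
  have hsum : Summable fun n : ℕ => ∫ x in Set.Ioc (0 : ℝ) 1,
      (x : ℂ) ^ (s / 2 - 1) * (Real.exp (-lam n * x) : ℂ) := by
    have := hd.prod
    simp only [Function.uncurry] at this
    simpa only [fun n => (aux_hasSum (lam n) ha0).tsum_eq] using this
  have ht := hasSum_tail ha
  rw [hJ, ← ht.tsum_eq, ← hsum.tsum_add ht.summable, zeta_eq_tsum_one_div_nat_add_one_cpow hs,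
    ← tsum_mul_left]
  refine tsum_congr fun n => ?_
  rw [gamma_term s hs n, ← Set.Ioc_union_Ioi_eq_Ioi zero_le_one,
    setIntegral_union (Set.Ioc_disjoint_Ioi le_rfl) measurableSet_Ioi]
  · exact (aux_int ha0 (lam_pos n)).mono_set fun x hx => hx.1
  · exact (aux_int ha0 (lam_pos n)).mono_set (Set.Ioi_subset_Ioi zero_le_one)
end

section
/- For every complex number s with Re(s) > 1, one has 1/s + J(s) = 1/(s-1) + ∫_1^∞ x^{-s/2-1/2} ψ(x) dx. -/
open MeasureTheory

lemma psi_summable {x : ℝ} (hx : 0 < x) :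
    Summable fun n : ℕ => Real.exp (-(n + 1 : ℝ) ^ 2 * Real.pi * x) := by
  have h : -(Real.pi * x) < 0 := by have := Real.pi_pos; have := mul_pos Real.pi_pos hx; linarith
  refine (Real.summable_exp_nat_mul_of_ge h (f := fun n : ℕ => (n + 1 : ℝ) ^ 2) ?_).congr ?_
  · intro i
    have : (0 : ℝ) ≤ i := by positivity
    nlinarith
  · intro i
    congr 1
    ring

lemma psi_nonneg (x : ℝ) : 0 ≤ psi x := tsum_nonneg fun _ => by positivity

lemma psi_anti : AntitoneOn psi (Set.Ioi 0) := by
  intro x hx y hy hxy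
  refine Summable.tsum_le_tsum (fun n => ?_) (psi_summable hy) (psi_summable hx)
  apply Real.exp_le_exp.mpr
  have : 0 ≤ (n + 1 : ℝ) ^ 2 * Real.pi := by positivity
  nlinarith

lemma theta_psi {x : ℝ} (hx : 0 < x) :
    ∑' n : ℤ, Real.exp (-Real.pi * x * (n : ℝ) ^ 2) = 1 + 2 * psi x := by
  have e1 : (fun n : ℕ => Real.exp (-Real.pi * x * (((n : ℤ) + 1 : ℤ) : ℝ) ^ 2)) =
      fun n : ℕ => Real.exp (-(n + 1 : ℝ) ^ 2 * Real.pi * x) := by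
    ext n; push_cast; congr 1; ring
  have e2 : (fun n : ℕ => Real.exp (-Real.pi * x * ((-((n : ℤ) + 1) : ℤ) : ℝ) ^ 2)) =
      fun n : ℕ => Real.exp (-(n + 1 : ℝ) ^ 2 * Real.pi * x) := by
    ext n; push_cast; congr 1; ring
  rw [tsum_of_add_one_of_neg_add_one (f := fun n : ℤ => Real.exp (-Real.pi * x * (n : ℝ) ^ 2))
    (by rw [e1]; exact psi_summable hx) (by rw [e2]; exact psi_summable hx), e1, e2]
  simp only [psi]
  simp
  ring

lemma psi_inv {y : ℝ} (hy : 0 < y) :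
    psi y⁻¹ = -1 / 2 + y ^ (1 / 2 : ℝ) / 2 + y ^ (1 / 2 : ℝ) * psi y := by
  have h := Real.tsum_exp_neg_mul_int_sq hy
  have h2 := theta_psi (inv_pos.mpr hy)
  simp only [div_eq_mul_inv (-Real.pi) y] at h
  rw [h2, theta_psi hy] at h
  have : 0 < y ^ (1 / 2 : ℝ) := Real.rpow_pos_of_pos hy _
  field_simp at h
  rw [one_div y] at h
  linarith

lemma psi_hasSum {x : ℝ} (hx : 0 < x) (hx1 : x ≤ 1) :
    HasSum (fun m : ℕ => cCoef m * ((1 - x) ^ m / m.factorial)) (psi x) := by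
  set f : ℕ × ℕ → ℝ := fun p => Real.exp (-(p.1 + 1 : ℝ) ^ 2 * Real.pi) *
    ((p.1 + 1 : ℝ) ^ 2 * Real.pi) ^ p.2 * ((1 - x) ^ p.2 / p.2.factorial) with hf
  have h1x : 0 ≤ 1 - x := by linarith
  have hrow : ∀ n : ℕ, HasSum (fun m => f (n, m)) (Real.exp (-(n + 1 : ℝ) ^ 2 * Real.pi * x)) := by
    intro n
    have := (NormedSpace.expSeries_div_hasSum_exp
      (((n + 1 : ℝ) ^ 2 * Real.pi) * (1 - x))).mul_left (Real.exp (-(n + 1 : ℝ) ^ 2 * Real.pi))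
    rw [← Real.exp_eq_exp_ℝ, ← Real.exp_add] at this
    have e1 : (fun m => f (n, m)) = fun m : ℕ => Real.exp (-(n + 1 : ℝ) ^ 2 * Real.pi) *
        ((((n + 1 : ℝ) ^ 2 * Real.pi) * (1 - x)) ^ m / m.factorial) := by
      ext m; simp only [hf]; rw [mul_pow _ (1 - x)]; ring
    have e2 : -(n + 1 : ℝ) ^ 2 * Real.pi * x =
        -(n + 1 : ℝ) ^ 2 * Real.pi + ((n + 1 : ℝ) ^ 2 * Real.pi) * (1 - x) := by ring
    rw [e1, e2]
    exact this
  have hs : Summable f := by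
    rw [summable_prod_of_nonneg (fun p => by simp only [hf]; positivity)]
    refine ⟨fun n => (hrow n).summable, ?_⟩
    simp_rw [fun n => (hrow n).tsum_eq]
    exact psi_summable hx
  have hcol : ∀ m : ℕ, ∑' n : ℕ, f (n, m) = cCoef m * ((1 - x) ^ m / m.factorial) := by
    intro m
    simp only [hf, cCoef]
    rw [tsum_mul_right]
  have htot : HasSum f (psi x) := by
    rw [hs.hasSum_iff, hs.tsum_prod]
    simp_rw [fun n => (hrow n).tsum_eq]
    rfl
  have h2 : HasSum (fun p : ℕ × ℕ => f p.swap) (psi x) := (Equiv.prodComm ℕ ℕ).hasSum_iff.mpr htot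
  have h3 := h2.prod_fiberwise (fun m => (hs.prod_symm.prod_factor m).hasSum)
  simp only [Prod.swap_prod_mk, hcol] at h3
  exact h3

lemma cCoef_nonneg (m : ℕ) : 0 ≤ cCoef m := tsum_nonneg fun _ => by positivity

lemma inv_image : (fun y : ℝ => y⁻¹) '' Set.Ioi 1 = Set.Ioo 0 1 := by
  have := Set.image_inv_eq_inv (s := Set.Ioi (1 : ℝ))
  rw [Set.inv_Ioi₀ one_pos, inv_one] at this
  exact this

lemma psi_int {u : ℂ} (hu : 1 / 2 < u.re) :
    IntegrableOn (fun x : ℝ => (x : ℂ) ^ (-u - 1 / 2) * (psi x : ℂ)) (Set.Ioi 1) := by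
  have h : IntegrableOn (fun t : ℝ => (t : ℂ) ^ (-u - 1 / 2)) (Set.Ioi 1) :=
    integrableOn_Ioi_cpow_of_lt (by simp; linarith) one_pos
  have hm : AEMeasurable psi (volume.restrict (Set.Ioi 1)) :=
    aemeasurable_restrict_of_antitoneOn measurableSet_Ioi
      (psi_anti.mono (Set.Ioi_subset_Ioi zero_le_one))
  have := Integrable.bdd_mul (c := psi 1) h (f := fun x : ℝ => (psi x : ℂ))
    (Complex.measurable_ofReal.comp_aemeasurable hm).aestronglyMeasurable ?_
  · exact this.congr (by filter_upwards with x using mul_comm _ _)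
  · filter_upwards [ae_restrict_mem measurableSet_Ioi] with x hx
    rw [Complex.norm_real, Real.norm_of_nonneg (psi_nonneg x)]
    have hx : 1 < x := hx
    exact psi_anti (by simp) (by simp; linarith) hx.le

lemma transformed {u : ℂ} {y : ℝ} (hy : 1 < y) :
    |-(y ^ 2)⁻¹| • (((y⁻¹ : ℝ) : ℂ) ^ (u - 1) * (psi y⁻¹ : ℂ)) =
      (-1 / 2) * (y : ℂ) ^ (-u - 1) + (1 / 2) * (y : ℂ) ^ (-u - 1 / 2) +
        (y : ℂ) ^ (-u - 1 / 2) * (psi y : ℂ) := by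
  have hy0 : 0 < y := by linarith
  have hyc : (y : ℂ) ≠ 0 := by exact_mod_cast hy0.ne'
  rw [psi_inv hy0, abs_neg, abs_of_pos (by positivity), Complex.real_smul]
  have e1 : ((y⁻¹ : ℝ) : ℂ) ^ (u - 1) = (y : ℂ) ^ (-(u - 1)) := by
    rw [Complex.ofReal_inv, Complex.inv_cpow, Complex.cpow_neg]
    rw [Complex.arg_ofReal_of_nonneg hy0.le]
    exact Real.pi_pos.ne
  have e2 : (((y ^ 2)⁻¹ : ℝ) : ℂ) = (y : ℂ) ^ (-2 : ℂ) := by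
    rw [Complex.cpow_neg]
    push_cast
    congr 1
    exact_mod_cast (Complex.cpow_natCast (y : ℂ) 2).symm
  have e3 : ((y ^ (1 / 2 : ℝ) : ℝ) : ℂ) = (y : ℂ) ^ (1 / 2 : ℂ) := by
    rw [Complex.ofReal_cpow hy0.le]; norm_num
  have e4 : (y : ℂ) ^ (-u - 1 / 2) = (y : ℂ) ^ (-u - 1) * (y : ℂ) ^ (1 / 2 : ℂ) := by
    rw [← Complex.cpow_add _ _ hyc]; congr 1; ring
  have e5 : (y : ℂ) ^ (-u - 1) = (y : ℂ) ^ (-2 : ℂ) * (y : ℂ) ^ (-(u - 1)) := by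
    rw [← Complex.cpow_add _ _ hyc]; congr 1; ring
  rw [e1, e2, e4, e5]
  push_cast [e3]
  ring

lemma deriv_inv_aux : ∀ y ∈ Set.Ioi (1 : ℝ),
    HasDerivWithinAt (fun y : ℝ => y⁻¹) (-(y ^ 2)⁻¹) (Set.Ioi 1) y := by
  intro y hy
  have hy : 1 < y := hy
  exact (hasDerivAt_inv (by linarith)).hasDerivWithinAt

lemma pieces {u : ℂ} (hu : 1 / 2 < u.re) :
    IntegrableOn (fun x : ℝ => (-1 / 2) * (x : ℂ) ^ (-u - 1)) (Set.Ioi 1) ∧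
    IntegrableOn (fun x : ℝ => (1 / 2) * (x : ℂ) ^ (-u - 1 / 2)) (Set.Ioi 1) := by
  constructor
  · exact (integrableOn_Ioi_cpow_of_lt (by simp; linarith) one_pos).const_mul _
  · exact (integrableOn_Ioi_cpow_of_lt (by simp; linarith) one_pos).const_mul _

lemma int01 {u : ℂ} (hu : 1 / 2 < u.re) :
    IntegrableOn (fun x : ℝ => (x : ℂ) ^ (u - 1) * (psi x : ℂ)) (Set.Ioo 0 1) := by
  rw [← inv_image, integrableOn_image_iff_integrableOn_abs_deriv_smul measurableSet_Ioi
    deriv_inv_aux inv_injective.injOn]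
  refine IntegrableOn.congr_fun (((pieces hu).1.add (pieces hu).2).add (psi_int hu)) ?_
    measurableSet_Ioi
  intro y hy
  exact (transformed hy).symm

lemma int01_eq {u : ℂ} (hu : 1 / 2 < u.re) :
    ∫ x in Set.Ioo (0 : ℝ) 1, (x : ℂ) ^ (u - 1) * (psi x : ℂ) =
      -1 / (2 * u) + 1 / (2 * u - 1) +
        ∫ x in Set.Ioi (1 : ℝ), (x : ℂ) ^ (-u - 1 / 2) * (psi x : ℂ) := by
  rw [← inv_image, integral_image_eq_integral_abs_deriv_smul measurableSet_Ioi
    deriv_inv_aux inv_injective.injOn]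
  rw [setIntegral_congr_fun measurableSet_Ioi (fun y hy => transformed hy)]
  have := integral_add ((pieces hu).1.add (pieces hu).2) (psi_int hu)
  simp only [Pi.add_apply] at this
  rw [this, integral_add (pieces hu).1 (pieces hu).2, integral_const_mul, integral_const_mul,
    integral_Ioi_cpow_of_lt (by simp; linarith) one_pos,
    integral_Ioi_cpow_of_lt (by simp; linarith) one_pos]
  have hu0 : u ≠ 0 := by rintro rfl; simp at hu; linarith
  have hu1 : 2 * u - 1 ≠ 0 := by
    intro h
    have := congrArg Complex.re h
    simp at this
    linarith
  have hu2 : -u - 1 / 2 + 1 ≠ 0 := by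
    intro h; apply hu1; linear_combination -2 * h
  congr 1
  simp only [Complex.ofReal_one, Complex.one_cpow]
  have a1 : -u - 1 + 1 = -u := by ring
  have a2 : -u - 1 / 2 + 1 = -(2 * u - 1) / 2 := by ring
  rw [a1, a2]
  field_simp

lemma beta_int {u : ℂ} (hu : 1 / 2 < u.re) (m : ℕ) :
    ∫ x in Set.Ioo (0 : ℝ) 1, (x : ℂ) ^ (u - 1) * ((cCoef m * ((1 - x) ^ m / m.factorial) : ℝ) : ℂ)
      = (cCoef m : ℂ) / ∏ k ∈ Finset.range (m + 1), (u + k) := by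
  have h := Complex.betaIntegral_eval_nat_add_one_right (u := u) (by linarith) m
  rw [Complex.betaIntegral, intervalIntegral.integral_of_le zero_le_one,
    integral_Ioc_eq_integral_Ioo] at h
  have e : ∀ x : ℝ, (x : ℂ) ^ (u - 1) * ((cCoef m * ((1 - x) ^ m / m.factorial) : ℝ) : ℂ) =
      ((cCoef m : ℂ) / m.factorial) * ((x : ℂ) ^ (u - 1) * (1 - (x : ℂ)) ^ ((m : ℂ) + 1 - 1)) := by
    intro x
    rw [add_sub_cancel_right, Complex.cpow_natCast]
    push_cast
    ring
  simp_rw [e]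
  rw [integral_const_mul, h]
  have : (m.factorial : ℂ) ≠ 0 := by exact_mod_cast m.factorial_ne_zero
  field_simp

lemma J_eq {u : ℂ} (hu : 1 / 2 < u.re) :
    HasSum (fun m : ℕ => (cCoef m : ℂ) / ∏ k ∈ Finset.range (m + 1), (u + k))
      (∫ x in Set.Ioo (0 : ℝ) 1, (x : ℂ) ^ (u - 1) * (psi x : ℂ)) := by
  simp_rw [← beta_int hu]
  refine hasSum_integral_of_dominated_convergence
    (fun m x => ‖(x : ℂ) ^ (u - 1)‖ * (cCoef m * ((1 - x) ^ m / m.factorial))) ?_ ?_ ?_ ?_ ?_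
  · intro m
    apply Measurable.aestronglyMeasurable
    fun_prop
  · intro m
    filter_upwards [ae_restrict_mem measurableSet_Ioo] with x hx
    rw [norm_mul, Complex.norm_real, Real.norm_of_nonneg]
    have := cCoef_nonneg m
    have : 0 ≤ 1 - x := by linarith [hx.2]
    positivity
  · filter_upwards [ae_restrict_mem measurableSet_Ioo] with x hx
    exact (psi_hasSum hx.1 hx.2.le).summable.mul_left _
  · refine (int01 hu).norm.congr ?_
    filter_upwards [ae_restrict_mem measurableSet_Ioo] with x hx
    rw [((psi_hasSum hx.1 hx.2.le).mul_left _).tsum_eq, norm_mul, Complex.norm_real,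
      Real.norm_of_nonneg (psi_nonneg x)]
  · filter_upwards [ae_restrict_mem measurableSet_Ioo] with x hx
    exact (Complex.hasSum_ofReal.mpr (psi_hasSum hx.1 hx.2.le)).mul_left _

/-- For `Re(s) > 1`, `1/s + J(s) = 1/(s-1) + ∫_1^∞ x^{-s/2-1/2} ψ(x) dx`. -/
theorem one_div_add_J_eq (s : ℂ) (hs : 1 < s.re) :
    1 / s + J s =
      1 / (s - 1) + ∫ x in Set.Ioi (1 : ℝ), (x : ℂ) ^ (-s / 2 - 1 / 2) * (psi x : ℂ) := by
  have hu : 1 / 2 < (s / 2).re := by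
    have : (s / 2).re = s.re / 2 := by simp
    rw [this]; linarith
  have h : J s = _ := (J_eq hu).tsum_eq
  rw [h, int01_eq hu, neg_div, mul_div_cancel₀ s two_ne_zero, ← neg_div 2 s]
  ring
end

section
/- Σ_{n=1}^∞ e^{-n²π} = (π^{1/4}/Γ(3/4) - 1)/2. -/
open Real Filter Topology Set MeasureTheory

noncomputable def thA (t : ℝ) : ℝ := ∑' n : ℤ, rexp (-π * t * (n : ℝ) ^ 2)
noncomputable def thB (t : ℝ) : ℝ := ∑' n : ℤ, (-1 : ℝ) ^ n * rexp (-π * t * (n : ℝ) ^ 2)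

lemma thA_summable {t : ℝ} (ht : 0 < t) : Summable fun n : ℤ => rexp (-π * t * (n : ℝ) ^ 2) := by
  have h := (hasSum_nat_jacobiTheta (τ := (t : ℂ) * Complex.I) (by simpa using ht)).summable
  have h1 : Summable fun n : ℕ => rexp (-π * t * ((n : ℝ) + 1) ^ 2) := by
    rw [← Complex.summable_ofReal]
    refine h.congr fun n => ?_
    push_cast
    congr 1
    linear_combination (π * t * ((n : ℂ) + 1) ^ 2) * Complex.I_mul_I
  have h2 : Summable fun n : ℕ => rexp (-π * t * ((n : ℝ)) ^ 2) := by
    rw [← summable_nat_add_iff 1]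
    simpa using h1
  apply Summable.of_nat_of_neg <;> simpa using h2

lemma abs_sgn (n : ℤ) : ‖(-1 : ℝ) ^ n‖ = 1 := by simp

lemma thB_summable {t : ℝ} (ht : 0 < t) :
    Summable fun n : ℤ => ‖(-1 : ℝ) ^ n * rexp (-π * t * (n : ℝ) ^ 2)‖ := by
  simp only [norm_mul, abs_sgn, one_mul]
  simp only [Real.norm_eq_abs, abs_exp]
  exact thA_summable ht

lemma thA_summable' {t : ℝ} (ht : 0 < t) :
    Summable fun n : ℤ => ‖rexp (-π * t * (n : ℝ) ^ 2)‖ := (thA_summable ht).norm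

lemma tsum_rot (F : ℤ × ℤ → ℝ) (hF : ∀ m n : ℤ, Odd (m + n) → F (m, n) = 0) :
    ∑' p, F p = ∑' p : ℤ × ℤ, F (p.1 + p.2, p.1 - p.2) := by
  have hinj : Function.Injective (fun p : ℤ × ℤ => (p.1 + p.2, p.1 - p.2)) := by
    rintro ⟨a, b⟩ ⟨c, d⟩ h
    simp only [Prod.mk.injEq] at h ⊢
    omega
  refine (hinj.tsum_eq (f := F) ?_).symm
  rintro ⟨m, n⟩ h
  rcases Int.even_or_odd (m + n) with he | ho
  · obtain ⟨k, hk⟩ := he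
    exact ⟨(k, m - k), by simp only [Prod.mk.injEq]; omega⟩
  · exact absurd (hF m n ho) h

lemma sgn_odd {m n : ℤ} (h : Odd (m + n)) : (-1 : ℝ) ^ m + (-1 : ℝ) ^ n = 0 := by
  rcases Int.even_or_odd m with hm | hm <;> rcases Int.even_or_odd n with hn | hn
  · exact absurd h (by simpa using hm.add hn)
  · rw [hm.neg_one_zpow, hn.neg_one_zpow]; norm_num
  · rw [hm.neg_one_zpow, hn.neg_one_zpow]; norm_num
  · exact absurd h (by simpa using hm.add_odd hn)

lemma sgn_mul (m n : ℤ) : (-1 : ℝ) ^ m * (-1 : ℝ) ^ n = (-1 : ℝ) ^ (m + n) :=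
  (zpow_add₀ (by norm_num) _ _).symm

lemma exp_rot (t : ℝ) (j k : ℤ) :
    rexp (-π * t * ((j + k : ℤ) : ℝ) ^ 2) * rexp (-π * t * ((j - k : ℤ) : ℝ) ^ 2) =
    rexp (-π * (2 * t) * (j : ℝ) ^ 2) * rexp (-π * (2 * t) * (k : ℝ) ^ 2) := by
  rw [← Real.exp_add, ← Real.exp_add]
  congr 1
  push_cast
  ring

lemma th_sum {t : ℝ} (ht : 0 < t) : thA t ^ 2 + thB t ^ 2 = 2 * thA (2 * t) ^ 2 := by
  have ht2 : 0 < 2 * t := by linarith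
  rw [sq, sq, sq]
  simp only [thA, thB]
  rw [tsum_mul_tsum_of_summable_norm (thA_summable' ht) (thA_summable' ht),
    tsum_mul_tsum_of_summable_norm (thB_summable ht) (thB_summable ht),
    tsum_mul_tsum_of_summable_norm (thA_summable' ht2) (thA_summable' ht2),
    ← (summable_mul_of_summable_norm (thA_summable' ht) (thA_summable' ht)).tsum_add
     (summable_mul_of_summable_norm (thB_summable ht) (thB_summable ht)), tsum_rot, ← tsum_mul_left]
  · refine tsum_congr fun p => ?_
    have h1 := exp_rot t p.1 p.2
    have h2 : (-1 : ℝ) ^ (p.1 + p.2) * (-1 : ℝ) ^ (p.1 - p.2) = 1 := by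
      rw [sgn_mul]; apply Even.neg_one_zpow; exact ⟨p.1, by ring⟩
    linear_combination 2 * h1 + rexp (-π * t * ((p.1 + p.2 : ℤ) : ℝ) ^ 2) * rexp (-π * t * ((p.1 - p.2 : ℤ) : ℝ) ^ 2) * h2
  · intro m n h
    have h2 : (-1 : ℝ) ^ m * (-1 : ℝ) ^ n = -1 := by
      rw [sgn_mul]; exact h.neg_one_zpow
    linear_combination rexp (-π * t * (m : ℝ) ^ 2) * rexp (-π * t * (n : ℝ) ^ 2) * h2

lemma th_prod {t : ℝ} (ht : 0 < t) : thA t * thB t = thB (2 * t) ^ 2 := by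
  have ht2 : 0 < 2 * t := by linarith
  have h : thA t * thB t + thB t * thA t = 2 * (thB (2 * t) * thB (2 * t)) := by
    simp only [thA, thB]
    rw [tsum_mul_tsum_of_summable_norm (thA_summable' ht) (thB_summable ht),
      tsum_mul_tsum_of_summable_norm (thB_summable ht) (thA_summable' ht),
      tsum_mul_tsum_of_summable_norm (thB_summable ht2) (thB_summable ht2),
      ← (summable_mul_of_summable_norm (thA_summable' ht) (thB_summable ht)).tsum_add
       (summable_mul_of_summable_norm (thB_summable ht) (thA_summable' ht)), tsum_rot, ← tsum_mul_left]
    · refine tsum_congr fun p => ?_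
      have h1 := exp_rot t p.1 p.2
      have h2 : (-1 : ℝ) ^ (p.1 - p.2) = (-1 : ℝ) ^ (p.1 + p.2) := by
        rw [show p.1 + p.2 = (p.1 - p.2) + 2 * p.2 by ring, zpow_add₀ (by norm_num),
          Even.neg_one_zpow (n := 2 * p.2) ⟨p.2, by ring⟩, mul_one]
      have h3 := sgn_mul p.1 p.2
      rw [h2, ← h3]
      linear_combination 2 * (-1 : ℝ) ^ p.1 * (-1 : ℝ) ^ p.2 * h1
    · intro m n h
      linear_combination rexp (-π * t * (m : ℝ) ^ 2) * rexp (-π * t * (n : ℝ) ^ 2) * sgn_odd h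
  linarith [h, sq (thB (2 * t))]

lemma thA_tendsto : Tendsto thA atTop (𝓝 1) := by
  have h : Tendsto thA atTop (𝓝 (∑' n : ℤ, if n = 0 then (1 : ℝ) else 0)) := by
    unfold thA
    refine tendsto_tsum_of_dominated_convergence (bound := fun n : ℤ => rexp (-π * 1 * (n : ℝ) ^ 2))
      (thA_summable one_pos) ?_ ?_
    · intro n
      split_ifs with hn
      · simp [hn]
      · refine Real.tendsto_exp_atBot.comp ?_
        have hc : -π * (n : ℝ) ^ 2 < 0 := by
          have : (n : ℝ) ≠ 0 := by exact_mod_cast hn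
          have := pi_pos
          have : 0 < π * (n : ℝ) ^ 2 := by positivity
          linarith
        refine (tendsto_id.atTop_mul_const_of_neg hc).congr fun x => ?_
        simp only [id]; ring
    · filter_upwards [eventually_ge_atTop 1] with t ht n
      rw [Real.norm_eq_abs, abs_exp]
      apply Real.exp_le_exp.mpr
      have : 0 ≤ π * (n : ℝ) ^ 2 := by have := pi_pos; positivity
      nlinarith
  simpa using h

lemma thA_pos {t : ℝ} (ht : 0 < t) : 0 < thA t :=
  (thA_summable ht).tsum_pos (fun _ => (Real.exp_pos _).le) 0 (Real.exp_pos _)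

lemma thA_half : thA (1 / 2) ^ 2 = 2 * thA 2 ^ 2 := by
  have h := Real.tsum_exp_neg_mul_int_sq (a := 2) two_pos
  have h2 : thA 2 = 1 / (2 : ℝ) ^ (1 / 2 : ℝ) * thA (1 / 2) := by
    unfold thA
    rw [h]
    congr! 5
    ring
  rw [h2, ← Real.sqrt_eq_rpow, mul_pow, div_pow, Real.sq_sqrt (by norm_num)]
  ring

lemma thB_one : thB 1 ^ 2 = thA 1 ^ 2 * (√2 / 2) := by
  have e1 := th_sum (t := 1) one_pos
  have e2 := th_sum (t := 1 / 2) (by norm_num)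
  have e3 := th_prod (t := 1 / 2) (by norm_num)
  have e4 := thA_half
  norm_num at e1 e2 e3 e4
  have e5 : thA (1 / 2) ^ 2 * thB (1 / 2) ^ 2 = (thB 1 ^ 2) ^ 2 := by
    rw [← e3]; norm_num; ring
  norm_num at e5
  set a := thA 1 ^ 2
  set b := thB 1 ^ 2
  have ha : 0 ≤ a := sq_nonneg _
  have hb : 0 ≤ b := sq_nonneg _
  have key : 2 * b ^ 2 = a ^ 2 := by
    rw [e4] at e5 e2
    have : thB 2⁻¹ ^ 2 = 2 * a - 2 * thA 2 ^ 2 := by norm_num at e2 ⊢; linarith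
    have h' : thA 2 ^ 2 = (a + b) / 2 := by linarith
    norm_num at e5 this
    rw [this, h'] at e5
    linarith
  have hs : √2 ^ 2 = 2 := Real.sq_sqrt (by norm_num)
  have : b ^ 2 = (a * (√2 / 2)) ^ 2 := by rw [mul_pow, div_pow, hs]; linarith
  exact (pow_left_inj₀ hb (by positivity) two_ne_zero).mp this

noncomputable def KK (a b : ℝ) : ℝ := ∫ x : ℝ, (√((x ^ 2 + a ^ 2) * (x ^ 2 + b ^ 2)))⁻¹

lemma KK_half (a b : ℝ) :
    KK a b = 2 * ∫ x in Ioi (0 : ℝ), (√((x ^ 2 + a ^ 2) * (x ^ 2 + b ^ 2)))⁻¹ := by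
  rw [← integral_comp_abs]
  simp only [sq_abs, KK]

lemma KK_agm {a b : ℝ} (ha : 0 < a) (hb : 0 < b) : KK ((a + b) / 2) (√(a * b)) = KK a b := by
  have hab : 0 < a * b := mul_pos ha hb
  have himg : (fun t : ℝ => (t - a * b / t) / 2) '' Ioi 0 = univ := by
    refine eq_univ_of_forall fun u => ?_
    have hs : √(u ^ 2 + a * b) ^ 2 = u ^ 2 + a * b := Real.sq_sqrt (by positivity)
    have hlt : |u| < √(u ^ 2 + a * b) := by
      rw [← Real.sqrt_sq_eq_abs]
      exact Real.sqrt_lt_sqrt (sq_nonneg _) (by linarith)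
    have hp : 0 < u + √(u ^ 2 + a * b) := by linarith [neg_abs_le u]
    refine ⟨u + √(u ^ 2 + a * b), hp, ?_⟩
    simp only
    field_simp
    linear_combination hs
  have hinj : InjOn (fun t : ℝ => (t - a * b / t) / 2) (Ioi 0) := by
    intro x hx y hy h
    simp only [mem_Ioi] at hx hy
    simp only at h
    have h2 : (x - y) * (x * y + a * b) = 0 := by
      field_simp at h
      linear_combination h
    rcases mul_eq_zero.mp h2 with h3 | h3
    · linarith
    · have : 0 < x * y := mul_pos hx hy
      linarith
  have hder : ∀ x ∈ Ioi (0 : ℝ), HasDerivWithinAt (fun t : ℝ => (t - a * b / t) / 2)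
      ((1 + a * b / x ^ 2) / 2) (Ioi 0) x := by
    intro x hx
    have hx0 : x ≠ 0 := (mem_Ioi.mp hx).ne'
    have h := ((hasDerivAt_id x).sub ((hasDerivAt_inv hx0).const_mul (a * b))).div_const 2
    refine HasDerivAt.hasDerivWithinAt ?_
    have h' : HasDerivAt (fun t : ℝ => (t - a * b / t) / 2) ((1 - a * b * -(x ^ 2)⁻¹) / 2) x := by
      simp only [div_eq_mul_inv] at h ⊢
      exact h
    refine h'.congr_deriv ?_
    field_simp
    ring
  have key := integral_image_eq_integral_abs_deriv_smul measurableSet_Ioi hder hinj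
    (fun u => (√((u ^ 2 + ((a + b) / 2) ^ 2) * (u ^ 2 + √(a * b) ^ 2)))⁻¹)
  rw [himg, setIntegral_univ] at key
  rw [KK_half a b, KK, key, ← integral_const_mul]
  refine setIntegral_congr_fun measurableSet_Ioi fun t ht => ?_
  simp only [mem_Ioi] at ht
  simp only [smul_eq_mul]
  rw [Real.sq_sqrt hab.le, abs_of_pos (by positivity)]
  have e : (((t - a * b / t) / 2) ^ 2 + ((a + b) / 2) ^ 2) * (((t - a * b / t) / 2) ^ 2 + a * b)
      = ((t ^ 2 + a * b) / (4 * t ^ 2)) ^ 2 * ((t ^ 2 + a ^ 2) * (t ^ 2 + b ^ 2)) := by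
    field_simp
    ring
  rw [e, Real.sqrt_mul (sq_nonneg _), Real.sqrt_sq (by positivity)]
  have hs : 0 < √((t ^ 2 + a ^ 2) * (t ^ 2 + b ^ 2)) := Real.sqrt_pos.mpr (by positivity)
  field_simp
  ring

lemma KK_one : KK 1 1 = π := by
  rw [← integral_univ_inv_one_add_sq, KK]
  refine integral_congr_ae (Eventually.of_forall fun x => ?_)
  simp only
  rw [Real.sqrt_mul_self (by positivity)]
  ring_nf

lemma KK_smul {c a b : ℝ} (hc : 0 < c) : KK (c * a) (c * b) = c⁻¹ * KK a b := by
  have h := Measure.integral_comp_mul_left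
    (fun x : ℝ => (√((x ^ 2 + (c * a) ^ 2) * (x ^ 2 + (c * b) ^ 2)))⁻¹) c
  have h2 : ∫ x : ℝ, (√(((c * x) ^ 2 + (c * a) ^ 2) * ((c * x) ^ 2 + (c * b) ^ 2)))⁻¹
      = (c ^ 2)⁻¹ * KK a b := by
    rw [KK, ← integral_const_mul]
    refine integral_congr_ae (Eventually.of_forall fun x => ?_)
    simp only
    rw [show ((c * x) ^ 2 + (c * a) ^ 2) * ((c * x) ^ 2 + (c * b) ^ 2) =
      (c ^ 2) ^ 2 * ((x ^ 2 + a ^ 2) * (x ^ 2 + b ^ 2)) by ring, Real.sqrt_mul (by positivity),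
      Real.sqrt_sq (by positivity), mul_inv]
  rw [h2, smul_eq_mul, abs_of_pos (inv_pos.mpr hc)] at h
  have h3 : KK (c * a) (c * b) = c * ((c ^ 2)⁻¹ * KK a b) := by
    rw [h, KK]; field_simp
  rw [h3]; field_simp

lemma KK_tendsto {u v : ℕ → ℝ} (hu : Tendsto u atTop (𝓝 1)) (hv : Tendsto v atTop (𝓝 1)) :
    Tendsto (fun n => KK (u n) (v n)) atTop (𝓝 π) := by
  rw [← KK_one]
  unfold KK
  refine tendsto_integral_filter_of_dominated_convergence (fun x : ℝ => 4 * (1 + x ^ 2)⁻¹) ?_ ?_ ?_ ?_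
  · refine Eventually.of_forall fun n => ?_
    apply Measurable.aestronglyMeasurable
    fun_prop
  · filter_upwards [hu.eventually (lt_mem_nhds (by norm_num : (1 / 2 : ℝ) < 1)),
      hv.eventually (lt_mem_nhds (by norm_num : (1 / 2 : ℝ) < 1))] with n h1 h2
    refine Eventually.of_forall fun x => ?_
    rw [Real.norm_eq_abs, abs_of_nonneg (by positivity)]
    have e : 4 * (1 + x ^ 2)⁻¹ = (√(((1 + x ^ 2) / 4) ^ 2))⁻¹ := by
      rw [Real.sqrt_sq (by positivity)]; field_simp
    rw [e]
    apply inv_anti₀ (Real.sqrt_pos.mpr (by positivity))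
    apply Real.sqrt_le_sqrt
    rw [sq ((1 + x ^ 2) / 4)]
    apply mul_le_mul _ _ (by positivity) (by positivity) <;> nlinarith [sq_nonneg x]
  · exact integrable_inv_one_add_sq.const_mul 4
  · refine Eventually.of_forall fun x => ?_
    refine Tendsto.inv₀ ?_ (Real.sqrt_pos.mpr (by positivity)).ne'
    refine (Real.continuous_sqrt.tendsto _).comp ?_
    exact ((hu.pow 2).const_add _).mul ((hv.pow 2).const_add _)

lemma beta_eq : ∫ v in Ioo (0 : ℝ) 1, v ^ (-(3 / 4) : ℝ) * (1 - v) ^ (-(1 / 2) : ℝ) =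
    Real.Gamma (1 / 4) * Real.Gamma (1 / 2) / Real.Gamma (3 / 4) := by
  have h := Complex.betaIntegral_eq_Gamma_mul_div (1 / 4 : ℝ) (1 / 2 : ℝ)
    (by simp) (by simp)
  rw [Complex.Gamma_ofReal, Complex.Gamma_ofReal, ← Complex.ofReal_add, Complex.Gamma_ofReal,
    Complex.betaIntegral, intervalIntegral.integral_of_le zero_le_one, integral_Ioc_eq_integral_Ioo] at h
  norm_num at h
  rw [← Complex.ofReal_inj, ← integral_complex_ofReal]
  norm_num
  rw [← h]
  refine setIntegral_congr_fun measurableSet_Ioo fun v hv => ?_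
  simp only [mem_Ioo] at hv
  rw [Complex.ofReal_cpow hv.1.le, Complex.ofReal_cpow (by linarith)]
  push_cast
  norm_num

lemma KK_beta : KK 1 √2 =
    Real.Gamma (1 / 4) * Real.Gamma (1 / 2) / Real.Gamma (3 / 4) / 2 := by
  rw [← beta_eq, KK_half]
  have himg : (fun x : ℝ => ((1 + x ^ 2) ^ 2)⁻¹) '' Ioi 0 = Ioo 0 1 := by
    ext v
    constructor
    · rintro ⟨x, hx, rfl⟩
      simp only [mem_Ioi] at hx
      refine ⟨by positivity, inv_lt_one_of_one_lt₀ ?_⟩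
      nlinarith [pow_pos hx 2]
    · rintro ⟨h0, h1⟩
      have hs : √v ^ 2 = v := Real.sq_sqrt h0.le
      have hs0 : 0 < √v := Real.sqrt_pos.mpr h0
      have hs1 : √v < 1 := by nlinarith
      have hpos : 0 < (√v)⁻¹ - 1 := by
        have := (one_lt_inv₀ hs0).mpr hs1
        linarith
      refine ⟨√((√v)⁻¹ - 1), Real.sqrt_pos.mpr hpos, ?_⟩
      simp only
      rw [Real.sq_sqrt hpos.le, add_sub_cancel, inv_pow, inv_inv, hs]
  have hinj : InjOn (fun x : ℝ => ((1 + x ^ 2) ^ 2)⁻¹) (Ioi 0) := by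
    intro x hx y hy h
    simp only [mem_Ioi] at hx hy
    have h1 := inv_injective h
    have h2 := (pow_left_inj₀ (by positivity) (by positivity) two_ne_zero).mp h1
    exact (pow_left_inj₀ hx.le hy.le two_ne_zero).mp (by linarith)
  have hder : ∀ x ∈ Ioi (0 : ℝ), HasDerivWithinAt (fun x : ℝ => ((1 + x ^ 2) ^ 2)⁻¹)
      (-(4 * x / (1 + x ^ 2) ^ 3)) (Ioi 0) x := by
    intro x hx
    refine HasDerivAt.hasDerivWithinAt ?_
    have h := ((((hasDerivAt_id x).pow 2).const_add 1).pow 2).inv (c := fun x : ℝ => (1 + x ^ 2) ^ 2)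
      (x := x) (by positivity)
    have h' : HasDerivAt (fun x : ℝ => ((1 + x ^ 2) ^ 2)⁻¹) _ x := h
    refine h'.congr_deriv ?_
    simp
    field_simp
    ring
  have key := integral_image_eq_integral_abs_deriv_smul measurableSet_Ioi hder hinj
    (fun v => v ^ (-(3 / 4) : ℝ) * (1 - v) ^ (-(1 / 2) : ℝ))
  rw [himg] at key
  have key2 : (∫ x in Ioi (0 : ℝ), |-(4 * x / (1 + x ^ 2) ^ 3)| •
      ((((1 + x ^ 2) ^ 2)⁻¹ : ℝ) ^ (-(3 / 4) : ℝ) * (1 - ((1 + x ^ 2) ^ 2)⁻¹) ^ (-(1 / 2) : ℝ)))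
      = 4 * ∫ x in Ioi (0 : ℝ), (√((x ^ 2 + 1 ^ 2) * (x ^ 2 + √2 ^ 2)))⁻¹ := by
    rw [← integral_const_mul]
    refine setIntegral_congr_fun measurableSet_Ioi fun x hx => ?_
    simp only [mem_Ioi] at hx
    simp only [smul_eq_mul]
    have hx1 : 0 < 1 + x ^ 2 := by positivity
    rw [abs_neg, abs_of_pos (by positivity), Real.sq_sqrt (by norm_num)]
    have e1 : (((1 + x ^ 2) ^ 2)⁻¹ : ℝ) ^ (-(3 / 4) : ℝ) = (1 + x ^ 2) * √(1 + x ^ 2) := by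
      rw [Real.inv_rpow (by positivity), Real.rpow_neg (by positivity), inv_inv,
        ← Real.rpow_natCast, ← Real.rpow_mul hx1.le, Real.sqrt_eq_rpow]
      nth_rewrite 2 [← Real.rpow_one (1 + x ^ 2)]
      rw [← Real.rpow_add hx1]
      norm_num
    have e2 : (1 - ((1 + x ^ 2) ^ 2)⁻¹) ^ (-(1 / 2) : ℝ) = (x / (1 + x ^ 2) * √(x ^ 2 + 2))⁻¹ := by
      have : 1 - ((1 + x ^ 2) ^ 2)⁻¹ = (x / (1 + x ^ 2)) ^ 2 * (x ^ 2 + 2) := by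
        field_simp
        ring
      rw [this, Real.rpow_neg (by positivity), ← Real.sqrt_eq_rpow, Real.sqrt_mul (by positivity),
        Real.sqrt_sq (by positivity)]
    rw [e1, e2, Real.sqrt_mul (by positivity), one_pow, add_comm (x ^ 2) 1]
    have hs : √(1 + x ^ 2) ^ 2 = 1 + x ^ 2 := Real.sq_sqrt hx1.le
    have h1 : 0 < √(1 + x ^ 2) := Real.sqrt_pos.mpr hx1
    have h2 : 0 < √(x ^ 2 + 2) := Real.sqrt_pos.mpr (by positivity)
    field_simp
    rw [hs]
  rw [key, key2]
  ring

lemma KK_comm (a b : ℝ) : KK a b = KK b a := by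
  unfold KK
  simp only [mul_comm]

lemma KK_theta : KK (thA 1 ^ 2) (thB 1 ^ 2) = π := by
  have hp : ∀ n : ℕ, (0 : ℝ) < 2 ^ n := fun n => by positivity
  have hP : ∀ n : ℕ, 0 < thA (2 ^ n) ^ 2 := fun n => pow_pos (thA_pos (hp n)) 2
  have hS : ∀ n : ℕ, thA (2 ^ (n + 1)) ^ 2 = (thA (2 ^ n) ^ 2 + thB (2 ^ n) ^ 2) / 2 := by
    intro n
    have := th_sum (hp n)
    rw [pow_succ' (2 : ℝ) n]
    linarith
  have hM : ∀ n : ℕ, thB (2 ^ (n + 1)) ^ 2 = √(thA (2 ^ n) ^ 2 * thB (2 ^ n) ^ 2) := by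
    intro n
    rw [← mul_pow, th_prod (hp n), Real.sqrt_sq (sq_nonneg _), pow_succ' (2 : ℝ) n]
  have hQ : ∀ n : ℕ, 0 < thB (2 ^ n) ^ 2 := by
    intro n
    induction n with
    | zero =>
      rw [pow_zero, thB_one]
      have := thA_pos one_pos
      positivity
    | succ k ih =>
      rw [hM]
      exact Real.sqrt_pos.mpr (mul_pos (hP k) ih)
  have hK : ∀ n : ℕ, KK (thA (2 ^ n) ^ 2) (thB (2 ^ n) ^ 2) = KK (thA 1 ^ 2) (thB 1 ^ 2) := by
    intro n
    induction n with
    | zero => simp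
    | succ k ih => rw [hS, hM, KK_agm (hP k) (hQ k), ih]
  have hpow : Tendsto (fun n : ℕ => (2 : ℝ) ^ n) atTop atTop :=
    tendsto_pow_atTop_atTop_of_one_lt (by norm_num)
  have hPt : Tendsto (fun n : ℕ => thA (2 ^ n) ^ 2) atTop (𝓝 1) := by
    simpa using (thA_tendsto.comp hpow).pow 2
  have hQt : Tendsto (fun n : ℕ => thB (2 ^ n) ^ 2) atTop (𝓝 1) := by
    have h1 : Tendsto (fun n : ℕ => 2 * thA (2 ^ (n + 1)) ^ 2 - thA (2 ^ n) ^ 2) atTop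
        (𝓝 (2 * 1 - 1)) :=
      (((tendsto_add_atTop_iff_nat 1).mpr hPt).const_mul 2).sub hPt
    norm_num at h1
    refine h1.congr fun n => ?_
    rw [hS]; ring
  have hlim := KK_tendsto hPt hQt
  simp only [hK] at hlim
  exact tendsto_nhds_unique tendsto_const_nhds hlim

lemma thA_one : thA 1 = π ^ ((1 : ℝ) / 4) / Real.Gamma (3 / 4) := by
  have h := KK_theta
  have hA := thA_pos one_pos
  have hG : 0 < Real.Gamma (3 / 4) := Real.Gamma_pos_of_pos (by norm_num)
  have hs2 : √2 ^ 2 = 2 := Real.sq_sqrt (by norm_num)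
  have hsp : √π ^ 2 = π := Real.sq_sqrt pi_pos.le
  have hs0 : 0 < √2 := Real.sqrt_pos.mpr (by norm_num)
  have hsp0 : 0 < √π := Real.sqrt_pos.mpr pi_pos
  have hc : 0 < thA 1 ^ 2 * (√2 / 2) := by positivity
  have e : KK (thA 1 ^ 2) (thB 1 ^ 2) =
      KK (thA 1 ^ 2 * (√2 / 2) * √2) (thA 1 ^ 2 * (√2 / 2) * 1) := by
    rw [thB_one]
    congr 1
    · linear_combination (-thA 1 ^ 2 / 2) * hs2
    · ring
  rw [e, KK_smul hc, KK_comm, KK_beta, Real.Gamma_one_half_eq] at h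
  have hr := Real.Gamma_mul_Gamma_one_sub (1 / 4)
  rw [show (1 : ℝ) - 1 / 4 = 3 / 4 by norm_num, show π * (1 / 4) = π / 4 by ring,
    Real.sin_pi_div_four] at hr
  have hg : Real.Gamma (1 / 4) = π * √2 / Real.Gamma (3 / 4) := by
    rw [eq_div_iff hG.ne', hr]
    field_simp
    linear_combination -hs2
  rw [hg] at h
  have hsq : thA 1 ^ 2 = (π ^ ((1 : ℝ) / 4) / Real.Gamma (3 / 4)) ^ 2 := by
    have e4 : (π ^ ((1 : ℝ) / 4)) ^ 2 = √π := by
      rw [← Real.rpow_natCast, ← Real.rpow_mul pi_pos.le, Real.sqrt_eq_rpow]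
      norm_num
    rw [div_pow, e4]
    have := pi_pos
    field_simp at h ⊢
    linarith
  exact (pow_left_inj₀ hA.le (by positivity) two_ne_zero).mp hsq

lemma thA_nat : thA 1 = 1 + 2 * ∑' n : ℕ, rexp (-(n + 1 : ℝ) ^ 2 * π) := by
  have hsum : Summable fun n : ℕ => rexp (-(n + 1 : ℝ) ^ 2 * π) := by
    have := ((thA_summable one_pos).comp_injective
      (i := fun n : ℕ => (n : ℤ) + 1) (by intro a b h; simpa using h))
    refine this.congr fun n => ?_
    simp only [Function.comp]
    push_cast
    ring_nf
  have h := HasSum.of_add_one_of_neg_add_one (f := fun n : ℤ => rexp (-π * 1 * (n : ℝ) ^ 2))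
    (m := ∑' n : ℕ, rexp (-(n + 1 : ℝ) ^ 2 * π)) (m' := ∑' n : ℕ, rexp (-(n + 1 : ℝ) ^ 2 * π))
    (by convert hsum.hasSum using 3 with n; push_cast; ring)
    (by convert hsum.hasSum using 3 with n; push_cast; ring)
  rw [thA, h.tsum_eq]
  simp
  ring

/-- `∑_{n=1}^∞ e^{-n²π} = (π^{1/4}/Γ(3/4) - 1)/2`. -/
theorem tsum_exp_neg_sq_pi :
    ∑' n : ℕ, Real.exp (-(n + 1 : ℝ) ^ 2 * Real.pi) =
      (Real.pi ^ ((1 : ℝ) / 4) / Real.Gamma (3 / 4) - 1) / 2 := by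
  have h1 := thA_nat
  rw [thA_one] at h1
  linarith
end
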